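/- arXiv:2604.22362 — 5 statements merged into one kernel-verified Lean document; each statement's English description precedes it below -/
import Mathlib

section
/- Let (X,d,τ) be a timed-metric space. Then the null distance d̂_{d,τ} : X × X → [0,∞] is an extended distance: it is symmetric, satisfies the triangle inequality, vanishes exactly on the diagonal, and moreover d̂_{d,τ}(p,q) ≥ d(p,q) for all p,q ∈ X, and τ is 1-Lipschitz with respect to d̂_{d,τ}, i.e. |τ(p) − τ(q)| ≤ d̂_{d,τ}(p,q) for all p,q ∈ X. -/
open scoped ENNReal

/-- `p` is in the causal future of `q` w.r.t. the distance function `d`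
(written `p ∈ J⁺(q)`) iff `τ p - τ q = d q p`. -/
def causalFutureD {X : Type*} (d : X → X → ℝ) (τ : X → ℝ) (q p : X) : Prop :=
  τ p - τ q = d q p

/-- `p` and `q` are causally related (w.r.t. `d`, `τ`). -/
def causallyRelatedD {X : Type*} (d : X → X → ℝ) (τ : X → ℝ) (p q : X) : Prop :=
  causalFutureD d τ q p ∨ causalFutureD d τ p q

/-- The null distance `d̂_{d,τ}(x,y) ∈ [0,∞]`: the infimum of `∑ |τ(pᵢ) - τ(pᵢ₋₁)|` over
all finite chains `x = p₀, p₁, …, p_N = y` with consecutive points causally related;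
`∞` (the infimum of the empty set) if no such chain exists. -/
noncomputable def nullDistD {X : Type*} (d : X → X → ℝ) (τ : X → ℝ) (x y : X) : ℝ≥0∞ :=
  sInf { v | ∃ (N : ℕ) (p : ℕ → X), p 0 = x ∧ p N = y ∧
      (∀ i < N, causallyRelatedD d τ (p i) (p (i + 1))) ∧
      v = ENNReal.ofReal (∑ i ∈ Finset.range N, |τ (p (i + 1)) - τ (p i)|) }

section NullDist

variable {X : Type*} {τ : X → ℝ}

theorem causallyRelatedD.symm {d : X → X → ℝ} {x y : X} (h : causallyRelatedD d τ x y) :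
    causallyRelatedD d τ y x :=
  Or.symm h

theorem causallyRelatedD.abs_sub_eq_dist [PseudoMetricSpace X] {x y : X}
    (h : causallyRelatedD dist τ x y) : |τ y - τ x| = dist x y := by
  rcases h with h | h <;> unfold causalFutureD at h
  · rw [abs_sub_comm, h, dist_comm, abs_of_nonneg dist_nonneg]
  · rw [h, abs_of_nonneg dist_nonneg]

theorem nullDistD_le_of_chain {d : X → X → ℝ} (N : ℕ) (c : ℕ → X)
    (hc : ∀ i < N, causallyRelatedD d τ (c i) (c (i + 1))) :
    nullDistD d τ (c 0) (c N) ≤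
      ENNReal.ofReal (∑ i ∈ Finset.range N, |τ (c (i + 1)) - τ (c i)|) :=
  sInf_le ⟨N, c, rfl, rfl, hc, rfl⟩

theorem nullDistD_self (d : X → X → ℝ) (x : X) : nullDistD d τ x x = 0 := by
  simpa using nullDistD_le_of_chain (d := d) (τ := τ) 0 (fun _ => x) (by simp)

theorem nullDistD_le_swap (d : X → X → ℝ) (x y : X) :
    nullDistD d τ x y ≤ nullDistD d τ y x := by
  refine le_sInf ?_
  rintro _ ⟨N, c, rfl, rfl, hc, rfl⟩
  have h := nullDistD_le_of_chain (d := d) (τ := τ) N (fun i => c (N - i)) fun i hi => by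
    have := (hc (N - (i + 1)) (by omega)).symm
    rwa [show N - (i + 1) + 1 = N - i by omega] at this
  simp only [Nat.sub_zero, Nat.sub_self] at h
  refine h.trans_eq (congrArg ENNReal.ofReal ?_)
  rw [← Finset.sum_range_reflect (fun i => |τ (c (i + 1)) - τ (c i)|)]
  refine Finset.sum_congr rfl fun i hi => ?_
  have hi := Finset.mem_range.mp hi
  rw [show N - 1 - i + 1 = N - i by omega, show N - 1 - i = N - (i + 1) by omega, abs_sub_comm]

theorem nullDistD_comm (d : X → X → ℝ) (x y : X) : nullDistD d τ x y = nullDistD d τ y x :=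
  (nullDistD_le_swap d x y).antisymm (nullDistD_le_swap d y x)

theorem nullDistD_le_add_of_chains {d : X → X → ℝ} {M N : ℕ} {a b : ℕ → X} (hab : a M = b 0)
    (ha : ∀ i < M, causallyRelatedD d τ (a i) (a (i + 1)))
    (hb : ∀ i < N, causallyRelatedD d τ (b i) (b (i + 1))) :
    nullDistD d τ (a 0) (b N) ≤
      ENNReal.ofReal (∑ i ∈ Finset.range M, |τ (a (i + 1)) - τ (a i)|) +
        ENNReal.ofReal (∑ i ∈ Finset.range N, |τ (b (i + 1)) - τ (b i)|) := by
  let c : ℕ → X := fun i => if i < M then a i else b (i - M)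
  have hcl : ∀ i ≤ M, c i = a i := fun i hi => by
    rcases hi.lt_or_eq with h | rfl
    · simp [c, h]
    · simp [c, hab]
  have hcr : ∀ i, c (M + i) = b i := fun i => by simp [c]
  have h := nullDistD_le_of_chain (d := d) (τ := τ) (M + N) c fun i hi => by
    rcases lt_or_ge i M with h | h
    · rw [hcl i h.le, hcl (i + 1) h]
      exact ha i h
    · obtain ⟨k, rfl⟩ := Nat.exists_eq_add_of_le h
      rw [add_assoc, hcr, hcr]
      exact hb k (by omega)
  rw [hcl 0 (Nat.zero_le M), hcr, Finset.sum_range_add] at h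
  refine h.trans_eq ?_
  rw [← ENNReal.ofReal_add (Finset.sum_nonneg fun _ _ => abs_nonneg _)
    (Finset.sum_nonneg fun _ _ => abs_nonneg _)]
  congr 2
  · refine Finset.sum_congr rfl fun i hi => ?_
    have hi := Finset.mem_range.mp hi
    rw [hcl i hi.le, hcl (i + 1) hi]
  · refine Finset.sum_congr rfl fun i _ => ?_
    rw [add_assoc, hcr, hcr]

theorem nullDistD_triangle (d : X → X → ℝ) (x y z : X) :
    nullDistD d τ x z ≤ nullDistD d τ x y + nullDistD d τ y z := by
  conv_rhs => rw [nullDistD, ENNReal.sInf_add]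
  refine le_iInf₂ ?_
  rintro _ ⟨M, a, rfl, rfl, ha, rfl⟩
  rw [nullDistD.eq_1 d τ (a M) z, ENNReal.add_sInf]
  refine le_iInf₂ ?_
  rintro _ ⟨N, b, hb0, rfl, hb, rfl⟩
  exact nullDistD_le_add_of_chains hb0.symm ha hb

theorem edist_le_nullDistD [PseudoMetricSpace X] (x y : X) :
    edist x y ≤ nullDistD dist τ x y := by
  refine le_sInf ?_
  rintro _ ⟨N, c, rfl, rfl, hc, rfl⟩
  rw [edist_dist]
  refine ENNReal.ofReal_le_ofReal ((dist_le_range_sum_dist c N).trans_eq ?_)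
  exact Finset.sum_congr rfl fun i hi => (hc i (Finset.mem_range.mp hi)).abs_sub_eq_dist.symm

theorem ofReal_abs_sub_le_nullDistD (d : X → X → ℝ) (x y : X) :
    ENNReal.ofReal |τ x - τ y| ≤ nullDistD d τ x y := by
  refine le_sInf ?_
  rintro _ ⟨N, c, rfl, rfl, -, rfl⟩
  refine ENNReal.ofReal_le_ofReal ?_
  rw [abs_sub_comm, ← Finset.sum_range_sub (fun i => τ (c i))]
  exact Finset.abs_sum_le_sum_abs _ _

theorem nullDistD_eq_zero [MetricSpace X] {x y : X} : nullDistD dist τ x y = 0 ↔ x = y := by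
  refine ⟨fun h => ?_, fun h => h ▸ nullDistD_self dist x⟩
  exact edist_le_zero.mp (h ▸ edist_le_nullDistD x y)

end NullDist

/-- For a timed-metric space `(X, d, τ)`, the null distance `d̂_{d,τ}` is an extended
distance: symmetric, satisfies the triangle inequality, vanishes exactly on the diagonal;
moreover `d̂_{d,τ} ≥ d` and `τ` is `1`-Lipschitz with respect to `d̂_{d,τ}`. -/
theorem nullDist_extended_distance {X : Type*} [MetricSpace X]
    (τ : X → ℝ) (hτ0 : ∀ x, 0 ≤ τ x) (hτ : LipschitzWith 1 τ) :
    (∀ p q, nullDistD dist τ p q = nullDistD dist τ q p) ∧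
    (∀ p q r, nullDistD dist τ p r ≤ nullDistD dist τ p q + nullDistD dist τ q r) ∧
    (∀ p q, nullDistD dist τ p q = 0 ↔ p = q) ∧
    (∀ p q, edist p q ≤ nullDistD dist τ p q) ∧
    (∀ p q, ENNReal.ofReal |τ p - τ q| ≤ nullDistD dist τ p q) :=
  ⟨nullDistD_comm dist, nullDistD_triangle dist, fun _ _ => nullDistD_eq_zero,
    edist_le_nullDistD, ofReal_abs_sub_le_nullDistD dist⟩
end

section
/- Let (X,d,τ) be a timed-metric space such that the null distance d̂ = d̂_{d,τ} only takes finite values, so that (X, d̂, τ) is a timed-metric space. Then the causal structures of (X,d,τ) and (X, d̂, τ) agree: for all x, y ∈ X, τ(y) − τ(x) = d(x,y) if and only if τ(y) − τ(x) = d̂(x,y). Moreover, when these hold, d̂(x,y) = d(x,y). -/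
open scoped ENNReal

theorem abs_sub_eq_dist_of_causallyRelatedD {X : Type*} [PseudoMetricSpace X] {τ : X → ℝ} {p q : X}
    (h : causallyRelatedD dist τ p q) : |τ q - τ p| = dist p q := by
  rcases h with h | h <;> unfold causalFutureD at h
  · rw [abs_sub_comm, h, dist_comm, abs_of_nonneg dist_nonneg]
  · rw [h, abs_of_nonneg dist_nonneg]

/-- The null distance dominates the original distance: the null length of a chain is the sum
of the distances between its consecutive points. -/
theorem ofReal_dist_le_nullDistD {X : Type*} [PseudoMetricSpace X] (τ : X → ℝ) (x y : X) :
    ENNReal.ofReal (dist x y) ≤ nullDistD dist τ x y := by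
  refine le_sInf ?_
  rintro _ ⟨N, p, rfl, rfl, hp, rfl⟩
  refine ENNReal.ofReal_le_ofReal ((dist_le_range_sum_dist p N).trans_eq ?_)
  exact Finset.sum_congr rfl fun i hi =>
    (abs_sub_eq_dist_of_causallyRelatedD (hp i (Finset.mem_range.mp hi))).symm

theorem nullDistD_eq_of_causalFutureD {X : Type*} [PseudoMetricSpace X] {τ : X → ℝ} {x y : X}
    (h : causalFutureD dist τ x y) : nullDistD dist τ x y = ENNReal.ofReal (dist x y) := by
  refine le_antisymm (sInf_le ⟨1, fun i => if i = 0 then x else y, ?_⟩)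
    (ofReal_dist_le_nullDistD τ x y)
  have hxy : causallyRelatedD dist τ x y := Or.inr h
  simp [hxy, abs_sub_eq_dist_of_causallyRelatedD hxy]

/-- If the null distance `d̂ = d̂_{d,τ}` of a timed-metric space `(X, d, τ)` takes only finite
values (so that `(X, d̂, τ)` is a timed-metric space), then the causal structures of
`(X, d, τ)` and `(X, d̂, τ)` agree: `τ y - τ x = d x y ↔ τ y - τ x = d̂ x y`; moreover, when
these hold, `d̂ x y = d x y`. -/
theorem causal_structures_agree {X : Type*} [MetricSpace X]
    (τ : X → ℝ) (hτ0 : ∀ x, 0 ≤ τ x) (hτ : LipschitzWith 1 τ)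
    (hfin : ∀ p q, nullDistD dist τ p q ≠ ⊤) :
    (∀ x y, causalFutureD dist τ x y ↔
      τ y - τ x = (nullDistD dist τ x y).toReal) ∧
    (∀ x y, causalFutureD dist τ x y → (nullDistD dist τ x y).toReal = dist x y) := by
  have key : ∀ x y, causalFutureD dist τ x y → (nullDistD dist τ x y).toReal = dist x y :=
    fun x y h => by rw [nullDistD_eq_of_causalFutureD h, ENNReal.toReal_ofReal dist_nonneg]
  refine ⟨fun x y => ⟨fun h => ?_, fun h => le_antisymm ?_ ?_⟩, key⟩
  · rw [key x y h]
    exact h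
  · calc τ y - τ x ≤ dist (τ y) (τ x) := le_abs_self _
      _ ≤ dist y x := by simpa using hτ.dist_le_mul y x
      _ = dist x y := dist_comm y x
  · rw [h]
    exact (ENNReal.ofReal_le_iff_le_toReal (hfin x y)).mp (ofReal_dist_le_nullDistD τ x y)
end

section
/- Let (X,d,τ) be a sufficiently causally connected timed-metric space, i.e. X is path-connected, for any p ∈ J⁻(q) there exists a future-directed causal curve from p to q, and X = ⋃_{x∈X} interior(J⁻(x)) ∪ interior(J⁺(x)). Then the null distance d̂_{d,τ}(p,q) is finite for all p,q ∈ X, and consequently (X, d̂_{d,τ}, τ) is a causally-null timed-metric space. -/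
open scoped ENNReal

namespace NullDist

variable {X : Type*} {d : X → X → ℝ} {τ : X → ℝ}

theorem causallyRelatedD_symm {x y : X} (h : causallyRelatedD d τ x y) :
    causallyRelatedD d τ y x :=
  Or.symm h

/-- There is a finite causal chain from `x` to `y` of null length `s`. -/
def HasChain (d : X → X → ℝ) (τ : X → ℝ) (x y : X) (s : ℝ) : Prop :=
  ∃ (N : ℕ) (p : ℕ → X), p 0 = x ∧ p N = y ∧
    (∀ i < N, causallyRelatedD d τ (p i) (p (i + 1))) ∧
    s = ∑ i ∈ Finset.range N, |τ (p (i + 1)) - τ (p i)|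

theorem HasChain.refl (x : X) : HasChain d τ x x 0 :=
  ⟨0, fun _ => x, rfl, rfl, by simp, by simp⟩

theorem HasChain.single {x y : X} (h : causallyRelatedD d τ x y) :
    HasChain d τ x y |τ y - τ x| :=
  ⟨1, fun i => if i = 0 then x else y, by simp, by simp, by simpa using h, by simp⟩

theorem HasChain.symm {x y : X} {s : ℝ} (h : HasChain d τ x y s) : HasChain d τ y x s := by
  obtain ⟨N, p, h0, hN, hr, rfl⟩ := h
  have hstep : ∀ i < N, N - i = N - 1 - i + 1 ∧ N - (i + 1) = N - 1 - i := by omega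
  refine ⟨N, fun i => p (N - i), by simpa, by simpa, fun i hi => ?_, ?_⟩
  · simp only [(hstep i hi).1, (hstep i hi).2]
    exact causallyRelatedD_symm (hr _ (by omega))
  · rw [← Finset.sum_range_reflect]
    refine Finset.sum_congr rfl fun i hi => ?_
    obtain ⟨h1, h2⟩ := hstep i (Finset.mem_range.1 hi)
    simp only [h1, h2]
    exact abs_sub_comm _ _

theorem HasChain.trans {x y z : X} {s t : ℝ} (h : HasChain d τ x y s)
    (h' : HasChain d τ y z t) : HasChain d τ x z (s + t) := by
  obtain ⟨N, p, h0, hN, hr, rfl⟩ := h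
  obtain ⟨M, q, h0', hM, hr', rfl⟩ := h'
  let c : ℕ → X := fun i => if i ≤ N then p i else q (i - N)
  have hc : ∀ i ≤ N, c i = p i := fun i hi => if_pos hi
  have hc' : ∀ i, c (N + i) = q i := by
    rintro (_ | i)
    · simp [c, hN, h0']
    · simp [c]
  refine ⟨N + M, c, by simpa [hc] using h0, by rw [hc', hM], fun i hi => ?_, ?_⟩
  · obtain hlt | hle := lt_or_ge i N
    · rw [hc _ hlt.le, hc _ hlt]
      exact hr i hlt
    · obtain ⟨j, rfl⟩ := Nat.exists_eq_add_of_le hle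
      rw [add_assoc, hc', hc']
      exact hr' j (by omega)
  · rw [Finset.sum_range_add]
    congr 1
    · refine Finset.sum_congr rfl fun i hi => ?_
      have hi := Finset.mem_range.1 hi
      rw [hc _ hi.le, hc _ hi]
    · refine Finset.sum_congr rfl fun i _ => ?_
      rw [add_assoc, hc', hc']

theorem HasChain.nonneg {x y : X} {s : ℝ} (h : HasChain d τ x y s) : 0 ≤ s := by
  obtain ⟨N, p, -, -, -, rfl⟩ := h
  exact Finset.sum_nonneg fun _ _ => abs_nonneg _

theorem HasChain.nullDistD_le {x y : X} {s : ℝ} (h : HasChain d τ x y s) :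
    nullDistD d τ x y ≤ ENNReal.ofReal s := by
  obtain ⟨N, p, h0, hN, hr, rfl⟩ := h
  exact sInf_le ⟨N, p, h0, hN, hr, rfl⟩

theorem le_nullDistD {x y : X} {a : ℝ≥0∞}
    (h : ∀ s, HasChain d τ x y s → a ≤ ENNReal.ofReal s) : a ≤ nullDistD d τ x y := by
  refine le_sInf ?_
  rintro _ ⟨N, p, h0, hN, hr, rfl⟩
  exact h _ ⟨N, p, h0, hN, hr, rfl⟩

theorem nullDistD_comm (x y : X) : nullDistD d τ x y = nullDistD d τ y x :=
  le_antisymm (le_nullDistD fun _ h => h.symm.nullDistD_le)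
    (le_nullDistD fun _ h => h.symm.nullDistD_le)

theorem nullDistD_self (x : X) : nullDistD d τ x x = 0 := by
  simpa using (HasChain.refl (d := d) (τ := τ) x).nullDistD_le

theorem nullDistD_triangle (x y z : X) :
    nullDistD d τ x z ≤ nullDistD d τ x y + nullDistD d τ y z := by
  refine tsub_le_iff_right.1 (le_nullDistD fun s hs => ?_)
  refine tsub_le_iff_right.2 (tsub_le_iff_left.1 (le_nullDistD fun t ht => ?_))
  refine tsub_le_iff_left.2 ?_
  rw [← ENNReal.ofReal_add hs.nonneg ht.nonneg]
  exact (hs.trans ht).nullDistD_le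

theorem nullDistD_congr {d' : X → X → ℝ}
    (h : ∀ x y, causallyRelatedD d' τ x y ↔ causallyRelatedD d τ x y) (x y : X) :
    nullDistD d' τ x y = nullDistD d τ x y := by
  simp only [nullDistD, h]

section Metric

variable [MetricSpace X]

theorem dist_eq_of_causallyRelatedD {x y : X} (h : causallyRelatedD dist τ x y) :
    dist x y = |τ y - τ x| := by
  rcases h with h | h <;> unfold causalFutureD at h
  · rw [abs_sub_comm, h, abs_of_nonneg dist_nonneg, dist_comm]
  · rw [h, abs_of_nonneg dist_nonneg]

theorem HasChain.dist_le {x y : X} {s : ℝ} (h : HasChain dist τ x y s) : dist x y ≤ s := by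
  obtain ⟨N, p, rfl, rfl, hr, rfl⟩ := h
  refine (dist_le_range_sum_dist p N).trans (Finset.sum_le_sum fun i hi => ?_)
  exact (dist_eq_of_causallyRelatedD (hr i (Finset.mem_range.1 hi))).le

theorem ofReal_dist_le_nullDistD (x y : X) :
    ENNReal.ofReal (dist x y) ≤ nullDistD dist τ x y :=
  le_nullDistD fun _ h => ENNReal.ofReal_le_ofReal h.dist_le

/-- If every point has a neighbourhood contained in some causal cone and the space is connected,
any two points are joined by a causal chain. -/
theorem exists_hasChain [PreconnectedSpace X]
    (hcover : ∀ p : X, ∃ x : X,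
      p ∈ interior {y | causalFutureD dist τ y x} ∪
        interior {y | causalFutureD dist τ x y}) (p q : X) :
    ∃ s, HasChain dist τ p q s := by
  have hlocal : ∀ z : X, ∀ᶠ w in nhds z, ∃ s, HasChain dist τ z w s := by
    intro z
    obtain ⟨x, hx⟩ := hcover z
    have hrel : ∀ᶠ w in nhds z, causallyRelatedD dist τ x w := by
      rcases hx with hx | hx
      · exact Filter.mem_of_superset (mem_interior_iff_mem_nhds.1 hx) fun w hw => Or.inl hw
      · exact Filter.mem_of_superset (mem_interior_iff_mem_nhds.1 hx) fun w hw => Or.inr hw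
    exact hrel.mono fun w hw =>
      ⟨_, (HasChain.single hrel.self_of_nhds).symm.trans (HasChain.single hw)⟩
  have hclopen : IsClopen {w | ∃ s, HasChain dist τ p w s} := by
    refine ⟨⟨isOpen_iff_mem_nhds.2 fun z hz => ?_⟩, isOpen_iff_mem_nhds.2 fun z hz => ?_⟩
    · filter_upwards [hlocal z] with w ⟨s, hs⟩ ⟨t, ht⟩
      exact hz ⟨_, ht.trans hs.symm⟩
    · obtain ⟨t, ht⟩ := hz
      filter_upwards [hlocal z] with w ⟨s, hs⟩
      exact ⟨_, ht.trans hs⟩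
  have huniv := hclopen.eq_univ ⟨p, 0, HasChain.refl p⟩
  exact Set.eq_univ_iff_forall.1 huniv q

/-- The null distance has the same causal relation as the original distance. -/
theorem causalFutureD_nullDistD_iff (hτ : LipschitzWith 1 τ)
    (hfin : ∀ x y, nullDistD dist τ x y ≠ ⊤) (x y : X) :
    causalFutureD (fun x y => (nullDistD dist τ x y).toReal) τ x y ↔
      causalFutureD dist τ x y := by
  have hd : dist x y ≤ (nullDistD dist τ x y).toReal :=
    (ENNReal.ofReal_le_iff_le_toReal (hfin x y)).1 (ofReal_dist_le_nullDistD x y)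
  have hL : |τ x - τ y| ≤ dist x y := by simpa [Real.dist_eq] using hτ.dist_le_mul x y
  have hL' := neg_abs_le (τ x - τ y)
  unfold causalFutureD
  refine ⟨fun h => by linarith, fun h => ?_⟩
  have hle := (HasChain.single (d := dist) (τ := τ) (Or.inr h)).nullDistD_le
  rw [h, abs_of_nonneg dist_nonneg] at hle
  exact h.trans (hd.antisymm (ENNReal.toReal_le_of_le_ofReal dist_nonneg hle))

end Metric

end NullDist

/-- For a sufficiently causally connected timed-metric space `(X, d, τ)` (path-connected,
causally connected, and `X = ⋃ₓ interior(J⁻(x)) ∪ interior(J⁺(x))`), the null distance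
`d̂_{d,τ}` is everywhere finite, and `(X, d̂_{d,τ}, τ)` is a causally-null timed-metric
space. -/
theorem sufficiently_causally_connected_causally_null {X : Type*} [MetricSpace X]
    (τ : X → ℝ) (hτ0 : ∀ x, 0 ≤ τ x) (hτ : LipschitzWith 1 τ)
    (hpath : PathConnectedSpace X)
    (hcc : ∀ p q : X, causalFutureD dist τ p q →
      ∃ γ : ℝ → X, ContinuousOn γ (Set.Icc 0 1) ∧ γ 0 = p ∧ γ 1 = q ∧
        ∀ s ∈ Set.Icc (0:ℝ) 1, ∀ t ∈ Set.Icc (0:ℝ) 1, s ≤ t →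
          causalFutureD dist τ (γ s) (γ t))
    (hcover : ∀ p : X, ∃ x : X,
      p ∈ interior {y | causalFutureD dist τ y x} ∪
        interior {y | causalFutureD dist τ x y}) :
    (∀ p q, nullDistD dist τ p q ≠ ⊤) ∧
    (∀ p q, (nullDistD dist τ p q).toReal = (nullDistD dist τ q p).toReal) ∧
    (∀ p q, (nullDistD dist τ p q).toReal = 0 ↔ p = q) ∧
    (∀ p q r, (nullDistD dist τ p r).toReal ≤
      (nullDistD dist τ p q).toReal + (nullDistD dist τ q r).toReal) ∧
    (∀ p q, |τ p - τ q| ≤ (nullDistD dist τ p q).toReal) ∧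
    (∀ p q, nullDistD (fun x y => (nullDistD dist τ x y).toReal) τ p q
      = ENNReal.ofReal ((nullDistD dist τ p q).toReal)) := by
  have hfin : ∀ p q, nullDistD dist τ p q ≠ ⊤ := fun p q => by
    obtain ⟨s, hs⟩ := NullDist.exists_hasChain hcover p q
    exact ne_top_of_le_ne_top ENNReal.ofReal_ne_top hs.nullDistD_le
  have hd : ∀ p q, dist p q ≤ (nullDistD dist τ p q).toReal := fun p q =>
    (ENNReal.ofReal_le_iff_le_toReal (hfin p q)).1 (NullDist.ofReal_dist_le_nullDistD p q)
  refine ⟨hfin, fun p q => by rw [NullDist.nullDistD_comm], fun p q => ⟨fun h => ?_, ?_⟩,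
    fun p q r => ?_, fun p q => ?_, fun p q => ?_⟩
  · exact dist_le_zero.1 (h ▸ hd p q)
  · rintro rfl
    simp [NullDist.nullDistD_self]
  · rw [← ENNReal.toReal_add (hfin p q) (hfin q r)]
    exact ENNReal.toReal_mono (ENNReal.add_ne_top.2 ⟨hfin p q, hfin q r⟩)
      (NullDist.nullDistD_triangle p q r)
  · refine le_trans ?_ (hd p q)
    simpa [Real.dist_eq] using hτ.dist_le_mul p q
  · rw [ENNReal.ofReal_toReal (hfin p q)]
    exact NullDist.nullDistD_congr (fun x y => or_congr
      (NullDist.causalFutureD_nullDistD_iff hτ hfin y x)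
      (NullDist.causalFutureD_nullDistD_iff hτ hfin x y)) p q
end

section
/- For any two compact timed-metric spaces (X₁,d₁,τ₁) and (X₂,d₂,τ₂), the timed-Gromov–Hausdorff distance is finite and satisfies d_{τ-GH}((X₁,d₁,τ₁),(X₂,d₂,τ₂)) ≤ d_{GH}((X₁,d₁),(X₂,d₂)) + τ_max, where d_{GH} is the Gromov–Hausdorff distance of the underlying metric spaces and τ_max = max{max_{x∈X₁} τ₁(x), max_{x∈X₂} τ₂(x)}. -/
/-- A bundled compact metric space. -/
structure CompMS : Type 1 where
  carrier : Type
  [metric : MetricSpace carrier]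
  [compact : CompactSpace carrier]

attribute [instance] CompMS.metric CompMS.compact

instance : CoeSort CompMS Type := ⟨CompMS.carrier⟩

/-- The set of values `d_H^{[0,τmax]×Z}(φ₁(X₁), φ₂(X₂))` over all compact metric spaces `Z`
and all time- and distance-preserving maps `φⱼ : Xⱼ → [0,τmax] × Z` into the max-product
space (the product metric is the `max`-metric, and `τ_prod` is the first coordinate), where
`τmax = max (sup τ₁) (sup τ₂)`. -/
def tauGHSet (X₁ X₂ : Type*) [MetricSpace X₁] [MetricSpace X₂]
    (τ₁ : X₁ → ℝ) (τ₂ : X₂ → ℝ) : Set ℝ :=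
  { r | ∃ (Z : CompMS)
      (φ₁ : X₁ → Set.Icc (0:ℝ) (max (⨆ x, τ₁ x) (⨆ x, τ₂ x)) × Z)
      (φ₂ : X₂ → Set.Icc (0:ℝ) (max (⨆ x, τ₁ x) (⨆ x, τ₂ x)) × Z),
      Isometry φ₁ ∧ Isometry φ₂ ∧
      (∀ x, ((φ₁ x).1 : ℝ) = τ₁ x) ∧ (∀ x, ((φ₂ x).1 : ℝ) = τ₂ x) ∧
      r = Metric.hausdorffDist (Set.range φ₁) (Set.range φ₂) }

/-- The timed-Gromov–Hausdorff distance. -/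
noncomputable def tauGHDist (X₁ X₂ : Type*) [MetricSpace X₁] [MetricSpace X₂]
    (τ₁ : X₁ → ℝ) (τ₂ : X₂ → ℝ) : ℝ :=
  sInf (tauGHSet X₁ X₂ τ₁ τ₂)

/-- A bundled metric space. -/
structure BMS : Type 1 where
  carrier : Type
  [metric : MetricSpace carrier]

attribute [instance] BMS.metric

instance : CoeSort BMS Type := ⟨BMS.carrier⟩

/-- The Gromov–Hausdorff distance: the infimum of `d_H^Z(φ₁(X₁), φ₂(X₂))` over all metric
spaces `Z` and all distance-preserving maps `φⱼ : Xⱼ → Z`. -/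
noncomputable def ghD (X₁ X₂ : Type*) [MetricSpace X₁] [MetricSpace X₂] : ℝ :=
  sInf { r | ∃ (Z : BMS) (φ₁ : X₁ → Z) (φ₂ : X₂ → Z),
      Isometry φ₁ ∧ Isometry φ₂ ∧
      r = Metric.hausdorffDist (Set.range φ₁) (Set.range φ₂) }

/-- Pairing an isometry with a `1`-Lipschitz function yields an isometry into the max-product. -/
theorem Isometry.prodMk_of_lipschitzWith_one {X Y Z : Type*} [PseudoMetricSpace X]
    [PseudoMetricSpace Y] [PseudoMetricSpace Z] {f : X → Y} {g : X → Z}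
    (hf : LipschitzWith 1 f) (hg : Isometry g) : Isometry fun x => (f x, g x) := by
  refine Isometry.of_dist_eq fun x y => ?_
  rw [Prod.dist_eq, hg.dist_eq]
  exact max_eq_right (by simpa using hf.dist_le_mul x y)

/-- For maps from compact spaces, every point of the first range is within the Hausdorff distance
of some point of the second. -/
theorem exists_dist_le_hausdorffDist_range {X Y Z : Type*} [TopologicalSpace X] [CompactSpace X]
    [TopologicalSpace Y] [CompactSpace Y] [Nonempty Y] [PseudoMetricSpace Z]
    {f : X → Z} {g : Y → Z} (hf : Continuous f) (hg : Continuous g) (x : X) :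
    ∃ y, dist (f x) (g y) ≤ Metric.hausdorffDist (Set.range f) (Set.range g) := by
  have hx : (Set.range f).Nonempty := ⟨f x, x, rfl⟩
  have hne := Metric.hausdorffEDist_ne_top_of_nonempty_of_bounded hx (Set.range_nonempty g)
    (isCompact_range hf).isBounded (isCompact_range hg).isBounded
  obtain ⟨_, ⟨y, rfl⟩, hy⟩ :=
    (isCompact_range hg).exists_infDist_eq_dist (Set.range_nonempty g) (f x)
  exact ⟨y, hy ▸ Metric.infDist_le_hausdorffDist_of_mem ⟨x, rfl⟩ hne⟩

/-- Isometric embeddings of two compact timed-metric spaces in a common metric space give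
time-preserving embeddings in a max-product space whose Hausdorff distance is larger by at most
the maximal time. -/
theorem exists_mem_tauGHSet_le (X₁ X₂ : Type)
    [MetricSpace X₁] [CompactSpace X₁] [Nonempty X₁]
    [MetricSpace X₂] [CompactSpace X₂] [Nonempty X₂]
    (τ₁ : X₁ → ℝ) (τ₂ : X₂ → ℝ) (hτ₁0 : ∀ x, 0 ≤ τ₁ x) (hτ₂0 : ∀ x, 0 ≤ τ₂ x)
    (hτ₁ : LipschitzWith 1 τ₁) (hτ₂ : LipschitzWith 1 τ₂)
    {Z : Type} [MetricSpace Z] {ψ₁ : X₁ → Z} {ψ₂ : X₂ → Z}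
    (h₁ : Isometry ψ₁) (h₂ : Isometry ψ₂) :
    ∃ r ∈ tauGHSet X₁ X₂ τ₁ τ₂,
      r ≤ Metric.hausdorffDist (Set.range ψ₁) (Set.range ψ₂) +
        max (⨆ x, τ₁ x) (⨆ x, τ₂ x) := by
  set T := max (⨆ x, τ₁ x) (⨆ x, τ₂ x)
  set D := Metric.hausdorffDist (Set.range ψ₁) (Set.range ψ₂)
  have hD0 : 0 ≤ D := Metric.hausdorffDist_nonneg
  have hmem₁ : ∀ x, τ₁ x ∈ Set.Icc 0 T := fun x => ⟨hτ₁0 x,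
    (le_ciSup (isCompact_range hτ₁.continuous).bddAbove x).trans (le_max_left _ _)⟩
  have hmem₂ : ∀ x, τ₂ x ∈ Set.Icc 0 T := fun x => ⟨hτ₂0 x,
    (le_ciSup (isCompact_range hτ₂.continuous).bddAbove x).trans (le_max_right _ _)⟩
  have hT0 : 0 ≤ T := (hmem₁ (Classical.arbitrary X₁)).1.trans (hmem₁ _).2
  let K : Set Z := Set.range ψ₁ ∪ Set.range ψ₂
  have hK : CompactSpace K := isCompact_iff_compactSpace.mp
    ((isCompact_range h₁.continuous).union (isCompact_range h₂.continuous))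
  let σ₁ : X₁ → Set.Icc (0 : ℝ) T := fun x => ⟨τ₁ x, hmem₁ x⟩
  let σ₂ : X₂ → Set.Icc (0 : ℝ) T := fun x => ⟨τ₂ x, hmem₂ x⟩
  let χ₁ : X₁ → K := fun x => ⟨ψ₁ x, Or.inl ⟨x, rfl⟩⟩
  let χ₂ : X₂ → K := fun x => ⟨ψ₂ x, Or.inr ⟨x, rfl⟩⟩
  have hσ₁ : LipschitzWith 1 σ₁ := fun x y => hτ₁ x y
  have hσ₂ : LipschitzWith 1 σ₂ := fun x y => hτ₂ x y
  have hχ₁ : Isometry χ₁ := fun x y => h₁ x y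
  have hχ₂ : Isometry χ₂ := fun x y => h₂ x y
  have hdist : ∀ x₁ x₂, dist (ψ₁ x₁) (ψ₂ x₂) ≤ D →
      dist (σ₁ x₁, χ₁ x₁) (σ₂ x₂, χ₂ x₂) ≤ D + T := fun x₁ x₂ h =>
    max_le ((by simpa using Real.dist_le_of_mem_Icc (hmem₁ x₁) (hmem₂ x₂) :
        dist (τ₁ x₁) (τ₂ x₂) ≤ T).trans (le_add_of_nonneg_left hD0))
      (h.trans (le_add_of_nonneg_right hT0))
  refine ⟨_, ⟨⟨K⟩, fun x => (σ₁ x, χ₁ x), fun x => (σ₂ x, χ₂ x),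
    Isometry.prodMk_of_lipschitzWith_one hσ₁ hχ₁, Isometry.prodMk_of_lipschitzWith_one hσ₂ hχ₂,
    fun _ => rfl, fun _ => rfl, rfl⟩,
    Metric.hausdorffDist_le_of_mem_dist (add_nonneg hD0 hT0) ?_ ?_⟩
  · rintro _ ⟨x₁, rfl⟩
    obtain ⟨x₂, h⟩ := exists_dist_le_hausdorffDist_range h₁.continuous h₂.continuous x₁
    exact ⟨_, ⟨x₂, rfl⟩, hdist x₁ x₂ h⟩
  · rintro _ ⟨x₂, rfl⟩
    obtain ⟨x₁, h⟩ := exists_dist_le_hausdorffDist_range h₂.continuous h₁.continuous x₂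
    rw [dist_comm, Metric.hausdorffDist_comm] at h
    exact ⟨_, ⟨x₁, rfl⟩, (dist_comm _ _).trans_le (hdist x₁ x₂ h)⟩

/-- For compact timed-metric spaces, the timed-Gromov–Hausdorff distance is finite (the
defining set of Hausdorff distances is nonempty) and satisfies
`d_{τ-GH} ≤ d_{GH} + τmax`, where `τmax = max (max τ₁) (max τ₂)`. -/
theorem tauGHDist_le_ghDist_add_tauMax (X₁ X₂ : Type)
    [MetricSpace X₁] [CompactSpace X₁] [Nonempty X₁]
    [MetricSpace X₂] [CompactSpace X₂] [Nonempty X₂]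
    (τ₁ : X₁ → ℝ) (τ₂ : X₂ → ℝ) (hτ₁0 : ∀ x, 0 ≤ τ₁ x) (hτ₂0 : ∀ x, 0 ≤ τ₂ x)
    (hτ₁ : LipschitzWith 1 τ₁) (hτ₂ : LipschitzWith 1 τ₂) :
    (tauGHSet X₁ X₂ τ₁ τ₂).Nonempty ∧
    tauGHDist X₁ X₂ τ₁ τ₂ ≤ ghD X₁ X₂ + max (⨆ x, τ₁ x) (⨆ x, τ₂ x) := by
  let _ : MetricSpace (X₁ ⊕ X₂) := Metric.metricSpaceSum
  have key := @exists_mem_tauGHSet_le X₁ X₂ _ _ _ _ _ _ τ₁ τ₂ hτ₁0 hτ₂0 hτ₁ hτ₂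
  have hinl : Isometry (Sum.inl : X₁ → X₁ ⊕ X₂) := Metric.isometry_inl
  have hinr : Isometry (Sum.inr : X₂ → X₁ ⊕ X₂) := Metric.isometry_inr
  have hbdd : BddBelow (tauGHSet X₁ X₂ τ₁ τ₂) := by
    refine ⟨0, ?_⟩
    rintro _ ⟨Z, φ₁, φ₂, -, -, -, -, rfl⟩
    exact Metric.hausdorffDist_nonneg
  refine ⟨(key hinl hinr).imp fun _ h => h.1, ?_⟩
  rw [← sub_le_iff_le_add]
  refine le_csInf ⟨_, ⟨X₁ ⊕ X₂⟩, Sum.inl, Sum.inr, hinl, hinr, rfl⟩ ?_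
  rintro _ ⟨Z, ψ₁, ψ₂, h₁, h₂, rfl⟩
  obtain ⟨r, hr, hle⟩ := key h₁ h₂
  exact sub_le_iff_le_add.mpr ((csInf_le hbdd hr).trans hle)
end

section
/- Given three compact timed-metric spaces (X_i,d_i,τ_i), i = 1,2,3, the timed-Gromov–Hausdorff distance satisfies the triangle inequality: d_{τ-GH}((X₁,d₁,τ₁),(X₃,d₃,τ₃)) ≤ d_{τ-GH}((X₁,d₁,τ₁),(X₂,d₂,τ₂)) + d_{τ-GH}((X₂,d₂,τ₂),(X₃,d₃,τ₃)). -/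
/-- Pairing a time function with an isometric embedding is an isometric embedding into the
max-product space. -/
theorem Isometry.prodMk_of_lipschitzWith {X T W : Type*} [PseudoMetricSpace X]
    [PseudoMetricSpace T] [PseudoMetricSpace W] {t : X → T} {f : X → W}
    (ht : LipschitzWith 1 t) (hf : Isometry f) : Isometry fun x => (t x, f x) := by
  refine Isometry.of_dist_eq fun x y => ?_
  rw [Prod.dist_eq, hf.dist_eq]
  exact max_eq_right (by simpa using ht.dist_le_mul x y)

section

variable {X₁ X₂ : Type} [MetricSpace X₁] [MetricSpace X₂] {τ₁ : X₁ → ℝ} {τ₂ : X₂ → ℝ}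

theorem bddBelow_tauGHSet : BddBelow (tauGHSet X₁ X₂ τ₁ τ₂) := by
  refine ⟨0, ?_⟩
  rintro _ ⟨Z, φ₁, φ₂, -, -, -, -, rfl⟩
  exact Metric.hausdorffDist_nonneg

theorem tauGHDist_nonneg : 0 ≤ tauGHDist X₁ X₂ τ₁ τ₂ := by
  refine Real.sInf_nonneg ?_
  rintro _ ⟨Z, φ₁, φ₂, -, -, -, -, rfl⟩
  exact Metric.hausdorffDist_nonneg

variable [CompactSpace X₁] [CompactSpace X₂]

/-- Isometric embeddings of two compact timed-metric spaces into a common metric space, which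
need not carry a time function, yield an admissible value in the definition of the
timed-Gromov–Hausdorff distance. -/
theorem exists_mem_tauGHSet_of_isometry
    (hτ₁0 : ∀ x, 0 ≤ τ₁ x) (hτ₂0 : ∀ x, 0 ≤ τ₂ x)
    (hτ₁ : LipschitzWith 1 τ₁) (hτ₂ : LipschitzWith 1 τ₂)
    {W : Type} [MetricSpace W] {f₁ : X₁ → W} {f₂ : X₂ → W}
    (hf₁ : Isometry f₁) (hf₂ : Isometry f₂) :
    ∃ r ∈ tauGHSet X₁ X₂ τ₁ τ₂, ∀ ε, 0 ≤ ε →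
      (∀ x, ∃ y, dist (τ₁ x) (τ₂ y) ≤ ε ∧ dist (f₁ x) (f₂ y) ≤ ε) →
      (∀ y, ∃ x, dist (τ₁ x) (τ₂ y) ≤ ε ∧ dist (f₁ x) (f₂ y) ≤ ε) → r ≤ ε := by
  have hcompact : IsCompact (Set.range f₁ ∪ Set.range f₂) :=
    (isCompact_range hf₁.continuous).union (isCompact_range hf₂.continuous)
  have : CompactSpace ↥(Set.range f₁ ∪ Set.range f₂) := isCompact_iff_compactSpace.mp hcompact
  have hmax₁ (x : X₁) : τ₁ x ≤ max (⨆ x, τ₁ x) (⨆ x, τ₂ x) :=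
    le_max_of_le_left (le_ciSup (isCompact_range hτ₁.continuous).bddAbove x)
  have hmax₂ (x : X₂) : τ₂ x ≤ max (⨆ x, τ₁ x) (⨆ x, τ₂ x) :=
    le_max_of_le_right (le_ciSup (isCompact_range hτ₂.continuous).bddAbove x)
  let t₁ (x : X₁) : Set.Icc (0 : ℝ) (max (⨆ x, τ₁ x) (⨆ x, τ₂ x)) := ⟨τ₁ x, hτ₁0 x, hmax₁ x⟩
  let t₂ (x : X₂) : Set.Icc (0 : ℝ) (max (⨆ x, τ₁ x) (⨆ x, τ₂ x)) := ⟨τ₂ x, hτ₂0 x, hmax₂ x⟩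
  let g₁ (x : X₁) : ↥(Set.range f₁ ∪ Set.range f₂) := ⟨f₁ x, .inl ⟨x, rfl⟩⟩
  let g₂ (x : X₂) : ↥(Set.range f₁ ∪ Set.range f₂) := ⟨f₂ x, .inr ⟨x, rfl⟩⟩
  have ht₁ : LipschitzWith 1 t₁ := hτ₁
  have ht₂ : LipschitzWith 1 t₂ := hτ₂
  have hg₁ : Isometry g₁ := hf₁
  have hg₂ : Isometry g₂ := hf₂
  refine ⟨_, ⟨⟨↥(Set.range f₁ ∪ Set.range f₂)⟩, fun x => (t₁ x, g₁ x), fun x => (t₂ x, g₂ x),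
    hg₁.prodMk_of_lipschitzWith ht₁, hg₂.prodMk_of_lipschitzWith ht₂,
    fun _ => rfl, fun _ => rfl, rfl⟩, fun ε hε h₁ h₂ => ?_⟩
  apply Metric.hausdorffDist_le_of_mem_dist hε
  · rintro _ ⟨x, rfl⟩
    obtain ⟨y, hy⟩ := h₁ x
    exact ⟨_, ⟨y, rfl⟩, max_le hy.1 hy.2⟩
  · rintro _ ⟨y, rfl⟩
    obtain ⟨x, hx⟩ := h₂ y
    refine ⟨_, ⟨x, rfl⟩, ?_⟩
    rw [dist_comm]
    exact max_le hx.1 hx.2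

theorem tauGHSet_nonempty
    (hτ₁0 : ∀ x, 0 ≤ τ₁ x) (hτ₂0 : ∀ x, 0 ≤ τ₂ x)
    (hτ₁ : LipschitzWith 1 τ₁) (hτ₂ : LipschitzWith 1 τ₂) :
    (tauGHSet X₁ X₂ τ₁ τ₂).Nonempty := by
  let _ : MetricSpace (X₁ ⊕ X₂) := Metric.metricSpaceSum
  obtain ⟨r, hr, -⟩ := exists_mem_tauGHSet_of_isometry hτ₁0 hτ₂0 hτ₁ hτ₂
    (Metric.isometry_inl (X := X₁) (Y := X₂)) Metric.isometry_inr
  exact ⟨r, hr⟩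

/-- Two compact timed-metric spaces at timed-Gromov–Hausdorff distance less than `ε` embed in a
common metric space so that every point of one is `ε`-close, in space and time, to a point of
the other. -/
theorem exists_isometry_of_tauGHDist_lt [Nonempty X₁] [Nonempty X₂]
    (hτ₁0 : ∀ x, 0 ≤ τ₁ x) (hτ₂0 : ∀ x, 0 ≤ τ₂ x)
    (hτ₁ : LipschitzWith 1 τ₁) (hτ₂ : LipschitzWith 1 τ₂)
    {ε : ℝ} (hε : tauGHDist X₁ X₂ τ₁ τ₂ < ε) :
    ∃ (W : Type) (_ : MetricSpace W) (f₁ : X₁ → W) (f₂ : X₂ → W), Isometry f₁ ∧ Isometry f₂ ∧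
      (∀ x, ∃ y, dist (τ₁ x) (τ₂ y) ≤ ε ∧ dist (f₁ x) (f₂ y) ≤ ε) ∧
      (∀ y, ∃ x, dist (τ₁ x) (τ₂ y) ≤ ε ∧ dist (f₁ x) (f₂ y) ≤ ε) := by
  obtain ⟨_, ⟨Z, φ₁, φ₂, hφ₁, hφ₂, ht₁, ht₂, rfl⟩, hlt⟩ :=
    exists_lt_of_csInf_lt (tauGHSet_nonempty hτ₁0 hτ₂0 hτ₁ hτ₂) hε
  have hfin : Metric.hausdorffEDist (Set.range φ₁) (Set.range φ₂) ≠ ⊤ :=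
    Metric.hausdorffEDist_ne_top_of_nonempty_of_bounded (Set.range_nonempty _)
      (Set.range_nonempty _) (isCompact_range hφ₁.continuous).isBounded
      (isCompact_range hφ₂.continuous).isBounded
  have htime (x : X₁) (y : X₂) : dist (τ₁ x) (τ₂ y) ≤ dist (φ₁ x) (φ₂ y) := by
    rw [← ht₁, ← ht₂]
    exact le_max_left _ _
  refine ⟨_, inferInstance, φ₁, φ₂, hφ₁, hφ₂, fun x => ?_, fun y => ?_⟩
  · obtain ⟨_, ⟨y, rfl⟩, hy⟩ :=
      Metric.exists_dist_lt_of_hausdorffDist_lt (Set.mem_range_self x) hlt hfin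
    exact ⟨y, (htime x y).trans hy.le, hy.le⟩
  · obtain ⟨_, ⟨x, rfl⟩, hx⟩ :=
      Metric.exists_dist_lt_of_hausdorffDist_lt' (Set.mem_range_self y) hlt hfin
    exact ⟨x, (htime x y).trans hx.le, hx.le⟩

end

/-- The timed-Gromov–Hausdorff distance satisfies the triangle inequality. -/
theorem tauGHDist_triangle (X₁ X₂ X₃ : Type)
    [MetricSpace X₁] [CompactSpace X₁] [Nonempty X₁]
    [MetricSpace X₂] [CompactSpace X₂] [Nonempty X₂]
    [MetricSpace X₃] [CompactSpace X₃] [Nonempty X₃]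
    (τ₁ : X₁ → ℝ) (τ₂ : X₂ → ℝ) (τ₃ : X₃ → ℝ)
    (hτ₁0 : ∀ x, 0 ≤ τ₁ x) (hτ₂0 : ∀ x, 0 ≤ τ₂ x) (hτ₃0 : ∀ x, 0 ≤ τ₃ x)
    (hτ₁ : LipschitzWith 1 τ₁) (hτ₂ : LipschitzWith 1 τ₂) (hτ₃ : LipschitzWith 1 τ₃) :
    tauGHDist X₁ X₃ τ₁ τ₃ ≤ tauGHDist X₁ X₂ τ₁ τ₂ + tauGHDist X₂ X₃ τ₂ τ₃ := by
  refine le_of_forall_pos_le_add fun δ hδ => ?_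
  have hnonneg₁₂ : 0 ≤ tauGHDist X₁ X₂ τ₁ τ₂ := tauGHDist_nonneg
  have hnonneg₂₃ : 0 ≤ tauGHDist X₂ X₃ τ₂ τ₃ := tauGHDist_nonneg
  obtain ⟨V, _, f₁, f₂, hf₁, hf₂, hf₁₂, hf₂₁⟩ :=
    exists_isometry_of_tauGHDist_lt hτ₁0 hτ₂0 hτ₁ hτ₂ (lt_add_of_pos_right _ (half_pos hδ))
  obtain ⟨W, _, g₂, g₃, hg₂, hg₃, hg₂₃, hg₃₂⟩ :=
    exists_isometry_of_tauGHDist_lt hτ₂0 hτ₃0 hτ₂ hτ₃ (lt_add_of_pos_right _ (half_pos hδ))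
  let L := Metric.toGlueL hf₂ hg₂
  let R := Metric.toGlueR hf₂ hg₂
  have hL : Isometry L := Metric.toGlueL_isometry hf₂ hg₂
  have hR : Isometry R := Metric.toGlueR_isometry hf₂ hg₂
  have hglue (x : X₁) (y : X₂) (z : X₃) :
      dist (L (f₁ x)) (R (g₃ z)) ≤ dist (f₁ x) (f₂ y) + dist (g₂ y) (g₃ z) := by
    have hLR : L (f₂ y) = R (g₂ y) := congrFun (Metric.toGlue_commute hf₂ hg₂) y
    rw [← hL.dist_eq, ← hR.dist_eq, ← hLR]
    exact dist_triangle _ _ _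
  obtain ⟨r, hr, hle⟩ := exists_mem_tauGHSet_of_isometry hτ₁0 hτ₃0 hτ₁ hτ₃
    (hL.comp hf₁) (hR.comp hg₃)
  refine (csInf_le bddBelow_tauGHSet hr).trans
    (hle _ (by positivity) (fun x => ?_) fun z => ?_)
  · obtain ⟨y, hty, hy⟩ := hf₁₂ x
    obtain ⟨z, htz, hz⟩ := hg₂₃ y
    exact ⟨z, by linarith [dist_triangle (τ₁ x) (τ₂ y) (τ₃ z)],
      (hglue x y z).trans (by linarith)⟩
  · obtain ⟨y, hty, hy⟩ := hg₃₂ z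
    obtain ⟨x, htx, hx⟩ := hf₂₁ y
    exact ⟨x, by linarith [dist_triangle (τ₁ x) (τ₂ y) (τ₃ z)],
      (hglue x y z).trans (by linarith)⟩
end
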